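/- arXiv:1112.0283 — 2 statements merged into one kernel-verified Lean document; each statement's English description precedes it below -/
import Mathlib

section
/- Let Δ be a simplicial complex on Fin ℓ and let j be a natural number. Suppose every finset σ of Fin ℓ with |σ| ≤ j is a face of Δ (equivalently, j ≤ M − 1 where M is the minimal cardinality of a non-face of Δ). Then the dimension of the simplicial evaluation code C(Δ,j) over ZMod 2 equals ∑_{m=0}^{j} C(ℓ, m). -/
open Finset

/-- The support of a vector over `ZMod 2`, as a finset. -/
def suppF {ℓ : ℕ} (v : Fin ℓ → ZMod 2) : Finset (Fin ℓ) :=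
  univ.filter fun i => v i ≠ 0

/-- The evaluation linear map sending a multivariate polynomial to its values on the
points of the coordinate subspace arrangement of a simplicial complex `Δ`. -/
noncomputable def evalMapΔ {ℓ : ℕ} (Δ : Finset (Finset (Fin ℓ))) :
    MvPolynomial (Fin ℓ) (ZMod 2) →ₗ[ZMod 2]
      ({v : Fin ℓ → ZMod 2 // suppF v ∈ Δ} → ZMod 2) where
  toFun f := fun p => MvPolynomial.eval p.1 f
  map_add' f g := by funext p; simp
  map_smul' c f := by funext p; simp

/-- The simplicial evaluation code `C(Δ, j)`. -/
noncomputable def simpCode {ℓ : ℕ} (Δ : Finset (Finset (Fin ℓ))) (j : ℕ) :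
    Submodule (ZMod 2) ({v : Fin ℓ → ZMod 2 // suppF v ∈ Δ} → ZMod 2) :=
  (MvPolynomial.restrictTotalDegree (Fin ℓ) (ZMod 2) j).map (evalMapΔ Δ)

/-- The evaluation on `P(Δ)` of the squarefree monomial with variable set `σ`. -/
def squarefreeEval {ℓ : ℕ} (Δ : Finset (Finset (Fin ℓ))) (σ : Finset (Fin ℓ)) :
    {v : Fin ℓ → ZMod 2 // suppF v ∈ Δ} → ZMod 2 :=
  fun p => ∏ i ∈ σ, p.1 i

theorem suppF_indicator {ℓ : ℕ} (σ : Finset (Fin ℓ)) :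
    suppF (fun i => if i ∈ σ then 1 else 0) = σ := by
  ext i
  simp [suppF]

theorem evalMapΔ_monomial {ℓ : ℕ} (Δ : Finset (Finset (Fin ℓ))) (n : Fin ℓ →₀ ℕ) :
    evalMapΔ Δ (MvPolynomial.monomial n 1) = squarefreeEval Δ n.support := by
  funext p
  change MvPolynomial.eval p.1 _ = _
  have pow_eq_self : ∀ (a : ZMod 2) (k : ℕ), k ≠ 0 → a ^ k = a := by
    intro a k hk
    fin_cases a
    · exact zero_pow hk
    · exact one_pow k
  rw [MvPolynomial.eval_monomial, one_mul]
  exact Finset.prod_congr rfl fun i hi => pow_eq_self _ _ (Finsupp.mem_support_iff.mp hi)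

theorem simpCode_eq_span {ℓ : ℕ} (Δ : Finset (Finset (Fin ℓ))) (j : ℕ) :
    simpCode Δ j = Submodule.span (ZMod 2)
      (Set.range fun σ : {σ : Finset (Fin ℓ) // σ.card ≤ j} => squarefreeEval Δ σ) := by
  rw [simpCode, MvPolynomial.restrictTotalDegree, MvPolynomial.restrictSupport_eq_span,
    Submodule.map_span]
  congr 1
  ext x
  constructor
  · rintro ⟨_, ⟨n, hn, rfl⟩, rfl⟩
    refine ⟨⟨n.support, le_trans ?_ hn⟩, (evalMapΔ_monomial Δ n).symm⟩
    rw [Finset.card_eq_sum_ones]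
    exact Finset.sum_le_sum fun i hi => Nat.one_le_iff_ne_zero.mpr (Finsupp.mem_support_iff.mp hi)
  · rintro ⟨⟨σ, hσ⟩, rfl⟩
    have hsupp : (Finsupp.indicator σ fun _ _ => 1 : Fin ℓ →₀ ℕ).support = σ := by
      ext i
      simp [Finsupp.indicator_apply]
    refine ⟨_, ⟨Finsupp.indicator σ fun _ _ => 1, ?_, rfl⟩, ?_⟩
    · rw [Set.mem_ofPred_eq, Finsupp.sum, hsupp]
      refine le_trans (le_of_eq ?_) hσ
      rw [Finset.card_eq_sum_ones]
      exact Finset.sum_congr rfl fun i hi => by simp [Finsupp.indicator_apply, hi]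
    · rw [evalMapΔ_monomial, hsupp]

theorem linearIndependent_squarefreeEval {ℓ : ℕ} (Δ : Finset (Finset (Fin ℓ))) (j : ℕ)
    (hfull : ∀ σ : Finset (Fin ℓ), σ.card ≤ j → σ ∈ Δ) :
    LinearIndependent (ZMod 2)
      fun σ : {σ : Finset (Fin ℓ) // σ.card ≤ j} => squarefreeEval Δ σ := by
  rw [Fintype.linearIndependent_iff]
  intro g hg
  suffices h : ∀ (σ : Finset (Fin ℓ)) (hσ : σ.card ≤ j), g ⟨σ, hσ⟩ = 0 from fun σ => h σ.1 σ.2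
  intro σ
  induction σ using Finset.strongInduction with
  | H σ ih =>
    intro hσ
    have hval := congrFun hg ⟨fun i => if i ∈ σ then 1 else 0, by
      rw [suppF_indicator]; exact hfull σ hσ⟩
    rw [Finset.sum_apply, Finset.sum_eq_single ⟨σ, hσ⟩] at hval
    · have hone : ∏ i ∈ σ, (if i ∈ σ then (1 : ZMod 2) else 0) = 1 :=
        Finset.prod_eq_one fun i hi => if_pos hi
      simpa only [Pi.smul_apply, Pi.zero_apply, squarefreeEval, hone, smul_eq_mul,
        mul_one] using hval
    · rintro ⟨τ, hτ⟩ - hne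
      rw [Pi.smul_apply]
      by_cases hsub : τ ⊆ σ
      · rw [ih τ (hsub.ssubset_of_ne fun h => hne (Subtype.ext h)) hτ, zero_smul]
      · obtain ⟨i, hiτ, hiσ⟩ := Finset.not_subset.mp hsub
        rw [squarefreeEval, Finset.prod_eq_zero hiτ (if_neg hiσ), smul_zero]
    · exact fun h => absurd (Finset.mem_univ _) h

theorem card_finset_card_le (ℓ j : ℕ) :
    Fintype.card {σ : Finset (Fin ℓ) // σ.card ≤ j} = ∑ m ∈ Finset.range (j + 1), ℓ.choose m := by
  rw [Fintype.card_subtype, Finset.card_eq_sum_card_fiberwise (f := Finset.card)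
    (t := Finset.range (j + 1)) fun σ hσ => by simpa [Nat.lt_succ_iff] using hσ]
  refine Finset.sum_congr rfl fun m hm => ?_
  have hm' : m ≤ j := Nat.lt_succ_iff.mp (Finset.mem_range.mp hm)
  rw [Finset.filter_filter, ← Fintype.card_fin ℓ, ← Finset.card_univ,
    ← Finset.card_powersetCard, Finset.card_univ, Fintype.card_fin]
  congr 1
  ext σ
  simp only [Finset.mem_filter, Finset.mem_univ, true_and, Finset.mem_powersetCard,
    Finset.subset_univ]
  exact ⟨fun h => h.2, fun h => ⟨h.le.trans hm', h⟩⟩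

theorem simplicial_code_dimension_small_degree {ℓ : ℕ} (Δ : Finset (Finset (Fin ℓ)))
    (hempty : ∅ ∈ Δ) (hdown : ∀ σ ∈ Δ, ∀ τ ⊆ σ, τ ∈ Δ) (j : ℕ)
    (hfull : ∀ σ : Finset (Fin ℓ), σ.card ≤ j → σ ∈ Δ) :
    Module.finrank (ZMod 2) (simpCode Δ j) =
      ∑ m ∈ Finset.range (j + 1), ℓ.choose m := by
  rw [simpCode_eq_span, finrank_span_eq_card (linearIndependent_squarefreeEval Δ j hfull),
    card_finset_card_le]
end

section
/- Let ℓ, h, s be natural numbers with 1 ≤ s ≤ ℓ and 1 ≤ h ≤ ℓ. Then, in the integers, ∑_{a=1}^{h} ∑_{t=1}^{s} (−2)^{t−1} · C(s, t) · C(ℓ−t, a−t) ≥ ∑_{a=1}^{h} C(ℓ−1, a−1). (Equivalently: the Hamming weight of the sum of any s distinct rows of the row block RB₁ of the generating matrix of the binary skeleton code K(ℓ,h,1) is at least the Hamming weight of a single such row.) -/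
open Finset

/-- The number of `a`-subsets of `U` containing a fixed subset `T`. -/
lemma card_filter_subset_powersetCard {α : Type*} [DecidableEq α] {T U : Finset α}
    (hTU : T ⊆ U) (a : ℕ) :
    #{A ∈ powersetCard a U | T ⊆ A} = if #T ≤ a then (#U - #T).choose (a - #T) else 0 := by
  split_ifs with hta
  · rw [← card_sdiff_of_subset hTU, ← card_powersetCard]
    refine card_bij' (fun A _ => A \ T) (fun B _ => B ∪ T) ?_ ?_ ?_ ?_
    · intro A hA
      simp only [mem_filter, mem_powersetCard] at hA ⊢
      exact ⟨sdiff_subset_sdiff hA.1.1 subset_rfl, by rw [card_sdiff_of_subset hA.2, hA.1.2]⟩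
    · intro B hB
      simp only [mem_filter, mem_powersetCard] at hB ⊢
      have hd : Disjoint B T := disjoint_of_subset_left hB.1 sdiff_disjoint
      refine ⟨⟨union_subset (hB.1.trans sdiff_subset) hTU, ?_⟩, subset_union_right⟩
      rw [card_union_of_disjoint hd, hB.2]
      omega
    · intro A hA
      exact sdiff_union_of_subset (mem_filter.1 hA).2
    · intro B hB
      have hd : Disjoint B T :=
        disjoint_of_subset_left (mem_powersetCard.1 hB).1 sdiff_disjoint
      exact union_sdiff_cancel_right hd
  · rw [card_eq_zero, filter_eq_empty_iff]
    intro A hA hTA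
    exact hta ((card_le_card hTA).trans_eq (mem_powersetCard.1 hA).2)

/-- Double counting of the pairs `T ⊆ A` with `T` a `t`-subset of `S` and `A` an `a`-subset
of `U`. -/
lemma sum_powersetCard_choose_card_inter {α : Type*} [DecidableEq α] {S U : Finset α}
    (hSU : S ⊆ U) (a t : ℕ) :
    ∑ A ∈ powersetCard a U, (#(A ∩ S)).choose t =
      (#S).choose t * if t ≤ a then (#U - t).choose (a - t) else 0 := by
  calc ∑ A ∈ powersetCard a U, (#(A ∩ S)).choose t
      = ∑ A ∈ powersetCard a U, #{T ∈ powersetCard t S | T ⊆ A} := by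
        refine sum_congr rfl fun A _ => ?_
        rw [← card_powersetCard]
        congr 1
        ext T
        simp only [mem_powersetCard, mem_filter, subset_inter_iff]
        tauto
    _ = ∑ T ∈ powersetCard t S, #{A ∈ powersetCard a U | T ⊆ A} := by
        simp only [card_filter]
        exact sum_comm
    _ = ∑ T ∈ powersetCard t S, if t ≤ a then (#U - t).choose (a - t) else 0 := by
        refine sum_congr rfl fun T hT => ?_
        obtain ⟨hTS, hT⟩ := mem_powersetCard.1 hT
        rw [card_filter_subset_powersetCard (hTS.trans hSU), hT]
    _ = _ := by rw [sum_const, card_powersetCard, smul_eq_mul]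

/-- The binomial expansion of the parity indicator `(1 - (1 - 2) ^ m) / 2`. -/
lemma sum_neg_two_pow_mul_choose {m s : ℕ} (hms : m ≤ s) :
    ∑ t ∈ Icc 1 s, (-2 : ℤ) ^ (t - 1) * (m.choose t : ℤ) = if Odd m then 1 else 0 := by
  have hbinom : ∑ t ∈ range (s + 1), (-2 : ℤ) ^ t * (m.choose t : ℤ) = (-1) ^ m := by
    rw [show (-1 : ℤ) = -2 + 1 by norm_num, add_pow]
    simp only [one_pow, mul_one]
    refine (sum_subset (range_mono (by omega)) fun t _ ht => ?_).symm
    rw [Nat.choose_eq_zero_of_lt (by simpa using ht), Nat.cast_zero, mul_zero]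
  have hdouble : ∑ t ∈ range (s + 1), (-2 : ℤ) ^ t * (m.choose t : ℤ) =
      1 - 2 * ∑ t ∈ Icc 1 s, (-2 : ℤ) ^ (t - 1) * (m.choose t : ℤ) := by
    rw [sum_range_succ', range_eq_Ico,
      sum_Ico_add' (fun t => (-2 : ℤ) ^ t * (m.choose t : ℤ)) 0 s 1,
      mul_sum, zero_add, show Ico 1 (s + 1) = Icc 1 s from rfl, sub_eq_add_neg, ← sum_neg_distrib,
      add_comm]
    congr 1
    · simp
    · refine sum_congr rfl fun t ht => ?_
      obtain ⟨k, rfl⟩ := Nat.exists_eq_add_of_le' (mem_Icc.1 ht).1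
      rw [Nat.add_sub_cancel, pow_succ]
      ring
  split_ifs with hm
  · rw [hm.neg_one_pow] at hbinom
    linarith
  · rw [(Nat.not_odd_iff_even.1 hm).neg_one_pow] at hbinom
    linarith

/-- Among the nonempty subsets of `U` of size at most `h`, at least as many meet `S` in an odd
number of elements as contain a given `x ∈ S`. -/
lemma card_filter_mem_le_card_filter_odd {α : Type*} [DecidableEq α] {S : Finset α}
    (U : Finset α) {x : α} (hx : x ∈ S) (h : ℕ) :
    #{A ∈ U.powerset | #A ∈ Icc 1 h ∧ x ∈ A} ≤
      #{A ∈ U.powerset | #A ∈ Icc 1 h ∧ Odd #(A ∩ S)} := by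
  refine card_le_card_of_injOn (fun A => if Odd #(A ∩ S) then A else A.erase x) ?_ ?_
  · intro A hA
    simp only [coe_filter, mem_powerset, mem_Icc, Set.mem_ofPred_eq] at hA ⊢
    obtain ⟨hAU, ⟨hA1, hAh⟩, hxA⟩ := hA
    split_ifs with hodd
    · exact ⟨hAU, ⟨hA1, hAh⟩, hodd⟩
    · have hodd' : Odd #(A.erase x ∩ S) := by
        have hxAS : x ∈ A ∩ S := mem_inter.2 ⟨hxA, hx⟩
        rw [erase_inter, card_erase_of_mem hxAS]
        exact Nat.Even.sub_odd (card_pos.2 ⟨x, hxAS⟩) (Nat.not_odd_iff_even.1 hodd) odd_one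
      refine ⟨(erase_subset _ _).trans hAU, ⟨?_, card_erase_le.trans hAh⟩, hodd'⟩
      exact hodd'.pos.trans_le (card_le_card inter_subset_left)
  · intro A hA B hB hAB
    simp only [coe_filter, Set.mem_ofPred_eq] at hA hB
    have hxA := hA.2.2
    have hxB := hB.2.2
    dsimp only at hAB
    split_ifs at hAB
    · exact hAB
    · exact absurd (hAB ▸ hxA) (notMem_erase x B)
    · exact absurd (hAB ▸ hxB) (notMem_erase x A)
    · rw [← insert_erase hxA, hAB, insert_erase hxB]

/-- Counting the subsets of `U` with a given property by size. -/
lemma sum_card_filter_powersetCard {α : Type*} [DecidableEq α] (U : Finset α) (I : Finset ℕ)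
    (p : Finset α → Prop) [DecidablePred p] :
    ∑ a ∈ I, #{A ∈ powersetCard a U | p A} = #{A ∈ U.powerset | #A ∈ I ∧ p A} := by
  rw [card_eq_sum_card_fiberwise (f := card) (t := I) fun A hA => (mem_filter.1 hA).2.1]
  refine sum_congr rfl fun a ha => ?_
  congr 1
  ext A
  simp only [mem_filter, mem_powersetCard, mem_powerset]
  constructor
  · rintro ⟨⟨hAU, rfl⟩, hp⟩
    exact ⟨⟨hAU, ha, hp⟩, rfl⟩
  · rintro ⟨⟨hAU, _, hp⟩, hcard⟩
    exact ⟨⟨hAU, hcard⟩, hp⟩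

theorem sum_of_s_rows_weight_ge_single_row (ℓ h s : ℕ)
    (hs1 : 1 ≤ s) (hsl : s ≤ ℓ) (hh1 : 1 ≤ h) (hhl : h ≤ ℓ) :
    ∑ a ∈ Icc 1 h, ((ℓ - 1).choose (a - 1) : ℤ) ≤
      ∑ a ∈ Icc 1 h, ∑ t ∈ Icc 1 s, (-2 : ℤ) ^ (t - 1) * (s.choose t : ℤ) *
        (if t ≤ a then ((ℓ - t).choose (a - t) : ℤ) else 0) := by
  have hsub : range s ⊆ range ℓ := range_mono hsl
  have hmem : ∀ a ∈ Icc 1 h, ((ℓ - 1).choose (a - 1) : ℤ) =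
      (#{A ∈ powersetCard a (range ℓ) | 0 ∈ A} : ℕ) := by
    intro a ha
    have hcount := card_filter_subset_powersetCard
      (singleton_subset_iff.2 (mem_range.2 (hs1.trans hsl))) a
    rw [card_singleton, if_pos (mem_Icc.1 ha).1, card_range] at hcount
    simp only [← hcount, singleton_subset_iff]
  have hodd : ∀ a ∈ Icc 1 h, ∑ t ∈ Icc 1 s, (-2 : ℤ) ^ (t - 1) * (s.choose t : ℤ) *
        (if t ≤ a then ((ℓ - t).choose (a - t) : ℤ) else 0) =
      (#{A ∈ powersetCard a (range ℓ) | Odd #(A ∩ range s)} : ℕ) := by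
    intro a _
    calc _ = ∑ t ∈ Icc 1 s, ∑ A ∈ powersetCard a (range ℓ),
          (-2 : ℤ) ^ (t - 1) * ((#(A ∩ range s)).choose t : ℤ) := by
          refine sum_congr rfl fun t _ => ?_
          have hcount := sum_powersetCard_choose_card_inter hsub a t
          rw [card_range, card_range] at hcount
          rw [← mul_sum, ← Nat.cast_sum, hcount, mul_assoc]
          push_cast
          rfl
      _ = ∑ A ∈ powersetCard a (range ℓ), if Odd #(A ∩ range s) then 1 else 0 := by
          rw [sum_comm]
          refine sum_congr rfl fun A _ => sum_neg_two_pow_mul_choose ?_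
          exact (card_le_card inter_subset_right).trans_eq (card_range s)
      _ = _ := by rw [sum_boole]
  rw [sum_congr rfl hmem, sum_congr rfl hodd, ← Nat.cast_sum, ← Nat.cast_sum,
    sum_card_filter_powersetCard, sum_card_filter_powersetCard]
  exact_mod_cast card_filter_mem_le_card_filter_odd _ (mem_range.2 hs1) h
end
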